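/- arXiv:1209.5376 — 2 statements merged into one kernel-verified Lean document; each statement's English description precedes it below -/
import Mathlib

section
/- For every positive integer N that is not a perfect square, there exist positive integers x and y satisfying N·x^2 + 1 = y^2. -/
/-- Solvability of the Pell equation N·x² + 1 = y² in positive integers for
every nonsquare positive integer N. -/
theorem pell_solvable (N : ℕ) (hN : 0 < N) (hns : ¬ IsSquare N) :
    ∃ x y : ℕ, 0 < x ∧ 0 < y ∧ N * x ^ 2 + 1 = y ^ 2 := by
  have hd : ¬ IsSquare (N : ℤ) := by rwa [Int.isSquare_natCast_iff]
  obtain ⟨x, y, hxy, hy⟩ := Pell.exists_of_not_isSquare (Int.natCast_pos.mpr hN) hd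
  have hx : x ≠ 0 := by
    rintro rfl
    nlinarith [mul_nonneg (Int.natCast_nonneg N) (sq_nonneg y)]
  refine ⟨y.natAbs, x.natAbs, Int.natAbs_pos.mpr hy, Int.natAbs_pos.mpr hx, ?_⟩
  zify
  rw [sq_abs, sq_abs]
  linarith
end

section
/- For every natural number n there exist n pairwise distinct right triangles with positive rational side lengths (i.e. n triples (a_i, b_i, c_i) of positive rationals with a_i^2 + b_i^2 = c_i^2, no two triples having the same unordered pair of legs) all having the same area a_i · b_i / 2. -/
/-- Fermat's step: a right triangle with legs `a ≠ b` and hypotenuse `c` yields the one with legs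
`|a ^ 2 - b ^ 2| / (2 * c)` and `2 * a * b * c / |a ^ 2 - b ^ 2|`, which has the same area. The
2-adic valuation of the first leg drops by one, so the process never repeats a triangle. -/
theorem exists_triangle_of_padicValRat (k : ℕ) :
    ∃ t : ℚ × ℚ × ℚ, (0 < t.1 ∧ 0 < t.2.1 ∧ 0 < t.2.2 ∧ t.1 ^ 2 + t.2.1 ^ 2 = t.2.2 ^ 2) ∧
      t.1 * t.2.1 = 12 ∧ padicValRat 2 t.1 = -k ∧ padicValRat 2 t.2.1 = k + 2 := by
  have h12 : padicValRat 2 12 = 2 := by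
    rw [show (12 : ℚ) = ((2 : ℕ) : ℚ) ^ 2 * (3 : ℕ) by norm_num,
      padicValRat.mul (by norm_num) (by norm_num), padicValRat.pow,
      padicValRat.self (by norm_num), padicValRat.of_nat,
      padicValNat.eq_zero_of_not_dvd (by norm_num)]
    norm_num
  suffices h : ∃ a b c : ℚ, 0 < a ∧ 0 < b ∧ 0 < c ∧ a ^ 2 + b ^ 2 = c ^ 2 ∧ a * b = 12 ∧
      padicValRat 2 a = -k by
    obtain ⟨a, b, c, ha, hb, hc, h, hab, hv⟩ := h
    refine ⟨(a, b, c), ⟨ha, hb, hc, h⟩, hab, hv, ?_⟩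
    have := padicValRat.mul (p := 2) ha.ne' hb.ne'
    rw [hab, h12, hv] at this
    change padicValRat 2 b = _
    linarith
  induction k with
  | zero =>
    refine ⟨3, 4, 5, by norm_num, by norm_num, by norm_num, by norm_num, by norm_num, ?_⟩
    rw [show (3 : ℚ) = (3 : ℕ) by norm_num, padicValRat.of_nat,
      padicValNat.eq_zero_of_not_dvd (by norm_num)]
    norm_num
  | succ k ih =>
    obtain ⟨a, b, c, ha, hb, hc, h, hab, hv⟩ := ih
    have hvb := padicValRat.mul (p := 2) ha.ne' hb.ne'
    rw [hab, h12, hv] at hvb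
    have hva2 : padicValRat 2 (a ^ 2) = -2 * k := by
      rw [padicValRat.pow, hv]; push_cast; ring
    have hvb2 : padicValRat 2 (b ^ 2) = 2 * (k + 2) := by
      rw [padicValRat.pow]; push_cast; linarith
    have hlt : padicValRat 2 (a ^ 2) < padicValRat 2 (b ^ 2) := by
      rw [hva2, hvb2]; linarith
    have hne : a ^ 2 - b ^ 2 ≠ 0 := fun e ↦ hlt.ne (by rw [sub_eq_zero.mp e])
    have hvc : padicValRat 2 c = -k := by
      have := padicValRat.add_eq_of_lt (p := 2) (by positivity) (pow_ne_zero 2 ha.ne')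
        (pow_ne_zero 2 hb.ne') hlt
      rw [h, hva2, padicValRat.pow] at this
      push_cast at this
      linarith
    have hvd : padicValRat 2 (a ^ 2 - b ^ 2) = -2 * k := by
      rw [sub_eq_add_neg, padicValRat.add_eq_of_lt (by rwa [← sub_eq_add_neg])
        (pow_ne_zero 2 ha.ne') (neg_ne_zero.mpr (pow_ne_zero 2 hb.ne')) (by rwa [padicValRat.neg]), hva2]
    obtain ⟨d, hd, hd2, hvd⟩ : ∃ d : ℚ, 0 < d ∧ d ^ 2 = (a ^ 2 - b ^ 2) ^ 2 ∧
        padicValRat 2 d = -2 * k := by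
      refine ⟨|a ^ 2 - b ^ 2|, abs_pos.mpr hne, sq_abs _, ?_⟩
      rcases abs_choice (a ^ 2 - b ^ 2) with e | e <;> simp only [e, padicValRat.neg, hvd]
    have hv2 : padicValRat 2 2 = 1 := by
      exact_mod_cast padicValRat.self (p := 2) (by norm_num)
    refine ⟨d / (2 * c), 2 * a * b * c / d, (c ^ 4 + 4 * a ^ 2 * b ^ 2) / (2 * c * d),
      by positivity, by positivity, by positivity, ?_, ?_, ?_⟩
    · have hd4 : d ^ 2 = c ^ 4 - 4 * a ^ 2 * b ^ 2 := by
        rw [hd2, show c ^ 4 = (c ^ 2) ^ 2 by ring, ← h]; ring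
      field_simp
      rw [show d ^ 4 = (d ^ 2) ^ 2 by ring, hd4]
      ring
    · rw [← hab]; field_simp
    · rw [padicValRat.div hd.ne' (by positivity), padicValRat.mul two_ne_zero hc.ne', hvd, hvc,
        hv2]
      push_cast; ring

/-- Fermat's challenge via Carcavi: for every n there are n pairwise distinct
rational right triangles (distinct unordered pairs of legs) with the same
area. -/
theorem fermat_equal_area_triangles (n : ℕ) :
    ∃ f : Fin n → ℚ × ℚ × ℚ,
      (∀ i, 0 < (f i).1 ∧ 0 < (f i).2.1 ∧ 0 < (f i).2.2 ∧
        (f i).1 ^ 2 + (f i).2.1 ^ 2 = (f i).2.2 ^ 2) ∧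
      (∀ i j, i ≠ j →
        ({(f i).1, (f i).2.1} : Set ℚ) ≠ ({(f j).1, (f j).2.1} : Set ℚ)) ∧
      (∀ i j, (f i).1 * (f i).2.1 / 2 = (f j).1 * (f j).2.1 / 2) := by
  choose t ht harea hv hv' using exists_triangle_of_padicValRat
  refine ⟨fun i ↦ t i, fun i ↦ ht i, fun i j hij hset ↦ hij (Fin.ext ?_), fun i j ↦ by
    simp only [harea]⟩
  have hmem : (t i).2.1 ∈ ({(t j).1, (t j).2.1} : Set ℚ) := hset ▸ by simp
  have hi := hv' i
  rcases hmem with e | e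
  · rw [e, hv] at hi
    omega
  · rw [Set.mem_singleton_iff.mp e, hv'] at hi
    omega
end
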